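/- If Σ_{t=1}^T f_t(X_{k+2}^t) + Q_{k+2} < 0 (the VO at position k+2 is of type 3), then W̃_0 = W_0: exchanging the bargaining positions k+1 and k+2 leaves the MNO's payoff unchanged. -/

import Mathlib

open Finset

/-- Total offloading benefit `Σ_{t<T} f_t(Σ_{n<N} b_n X_n^t)` (0-based indices). -/
noncomputable def socialOffload (T N : ℕ) (f : ℕ → ℝ → ℝ) (X : ℕ → ℕ → ℝ)
    (b : ℕ → Bool) : ℝ :=
  ∑ t ∈ range T, f t (∑ n ∈ range N, if b n then X n t else 0)

/-- `Waux T N f X Q j b = W_{N-j}(b)`: backward recursion on the number `j` of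
remaining bargaining steps.  At step `k = N - (j+1)` (0-based) the recursion is
`W_k(b) = ½·W_{k+1}(b,0) + ½·max{W_{k+1}(b,0), W_{k+1}(b,1) + Q_k}`. -/
noncomputable def Waux (T N : ℕ) (f : ℕ → ℝ → ℝ) (X : ℕ → ℕ → ℝ) (Q : ℕ → ℝ) :
    ℕ → (ℕ → Bool) → ℝ
  | 0, b => socialOffload T N f X b
  | j + 1, b =>
      (1 / 2) * Waux T N f X Q j (Function.update b (N - (j + 1)) false)
        + (1 / 2) *
          max (Waux T N f X Q j (Function.update b (N - (j + 1)) false))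
            (Waux T N f X Q j (Function.update b (N - (j + 1)) true) + Q (N - (j + 1)))

/-- The value function `W_k(b)` of the sequential one-to-many Nash bargaining
(0-based: VO `n` has parameters `Q n`, `X n ·`; `b` is the prefix of outcomes,
only its entries `0,…,k-1` matter). -/
noncomputable def W (T N : ℕ) (f : ℕ → ℝ → ℝ) (X : ℕ → ℕ → ℝ) (Q : ℕ → ℝ)
    (k : ℕ) (b : ℕ → Bool) : ℝ :=
  Waux T N f X Q (N - k) b

/-- Parameters obtained by interchanging the VOs at (0-based) positions `k` and
`k+1` (paper positions `k+1` and `k+2`). -/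
def swapQ (Q : ℕ → ℝ) (k : ℕ) : ℕ → ℝ :=
  fun n => if n = k then Q (k + 1) else if n = k + 1 then Q k else Q n

def swapX (X : ℕ → ℕ → ℝ) (k : ℕ) : ℕ → ℕ → ℝ :=
  fun n t => if n = k then X (k + 1) t else if n = k + 1 then X k t else X n t

/-- A concave function on `[0, ∞)` vanishing at `0` is subadditive there. -/
lemma ConcaveOn.map_add_le_of_map_zero {g : ℝ → ℝ} (hg : ConcaveOn ℝ (Set.Ici (0 : ℝ)) g)
    (h0 : g 0 = 0) {x y : ℝ} (hx : 0 ≤ x) (hy : 0 ≤ y) : g (x + y) ≤ g x + g y := by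
  rcases (add_nonneg hx hy).eq_or_lt with h | h
  · obtain rfl : x = 0 := by linarith
    obtain rfl : y = 0 := by linarith
    simp [h0]
  · have key : ∀ z, 0 ≤ z → z ≤ x + y → z / (x + y) * g (x + y) ≤ g z := by
      intro z hz hzxy
      have := hg.2 (Set.mem_Ici.2 h.le) (Set.mem_Ici.2 le_rfl) (div_nonneg hz h.le)
        (sub_nonneg.2 ((div_le_one h).2 hzxy)) (add_sub_cancel _ _)
      simpa [h0, div_mul_cancel₀ _ h.ne'] using this
    have hsum : x / (x + y) * g (x + y) + y / (x + y) * g (x + y) = g (x + y) := by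
      rw [← add_mul, ← add_div, div_self h.ne', one_mul]
    linarith [key x hx (by linarith), key y hy (by linarith)]

section

variable {T N : ℕ} {f : ℕ → ℝ → ℝ} {X : ℕ → ℕ → ℝ}

lemma socialOffload_update_true_le
    (hf : ∀ t, t < T → ConcaveOn ℝ (Set.Ici (0 : ℝ)) (f t) ∧ f t 0 = 0)
    (hX : ∀ n, n < N → ∀ t, t < T → 0 ≤ X n t) {n : ℕ} (hn : n < N) (b : ℕ → Bool) :
    socialOffload T N f X (Function.update b n true) ≤
      socialOffload T N f X (Function.update b n false) + ∑ t ∈ range T, f t (X n t) := by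
  unfold socialOffload
  rw [← sum_add_distrib]
  refine sum_le_sum fun t ht => ?_
  rw [mem_range] at ht
  have hsum : (∑ m ∈ range N, if Function.update b n true m then X m t else 0) =
      (∑ m ∈ range N, if Function.update b n false m then X m t else 0) + X n t := by
    have hXn : X n t = ∑ m ∈ range N, if m = n then X m t else 0 := by
      simp [hn]
    rw [hXn, ← sum_add_distrib]
    refine sum_congr rfl fun m _ => ?_
    by_cases hm : m = n
    · subst hm; simp
    · simp [hm]
  rw [hsum]
  refine (hf t ht).1.map_add_le_of_map_zero (hf t ht).2 (sum_nonneg fun m hm => ?_) (hX n hn t ht)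
  split_ifs
  · exact hX m (mem_range.1 hm) t ht
  · exact le_rfl

/-- Having reached an agreement with an earlier VO `n` raises the value function by at most the
stand-alone benefit of `n`. -/
lemma Waux_update_true_le
    (hf : ∀ t, t < T → ConcaveOn ℝ (Set.Ici (0 : ℝ)) (f t) ∧ f t 0 = 0)
    (hX : ∀ n, n < N → ∀ t, t < T → 0 ≤ X n t) (Q : ℕ → ℝ) {n : ℕ} (j : ℕ) (hn : n + j < N)
    (b : ℕ → Bool) :
    Waux T N f X Q j (Function.update b n true) ≤
      Waux T N f X Q j (Function.update b n false) + ∑ t ∈ range T, f t (X n t) := by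
  induction j generalizing b with
  | zero => exact socialOffload_update_true_le hf hX hn b
  | succ j ih =>
    have hne : n ≠ N - (j + 1) := by omega
    simp only [Waux, Function.update_comm hne]
    have hfalse := ih (by omega) (Function.update b (N - (j + 1)) false)
    have htrue := ih (by omega) (Function.update b (N - (j + 1)) true)
    have hmax := max_le_max hfalse (add_le_add_left htrue (Q (N - (j + 1))))
    rw [add_right_comm, max_add_add_right] at hmax
    linarith

/-- The MNO never agrees with a VO of type 3. -/
lemma Waux_succ_of_type3
    (hf : ∀ t, t < T → ConcaveOn ℝ (Set.Ici (0 : ℝ)) (f t) ∧ f t 0 = 0)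
    (hX : ∀ n, n < N → ∀ t, t < T → 0 ≤ X n t) {Q : ℕ → ℝ} {n j : ℕ} (hn : n + (j + 1) = N)
    (hQ : (∑ t ∈ range T, f t (X n t)) + Q n < 0) (b : ℕ → Bool) :
    Waux T N f X Q (j + 1) b = Waux T N f X Q j (Function.update b n false) := by
  have hsub : N - (j + 1) = n := by omega
  have hle := Waux_update_true_le hf hX Q (n := n) j (by omega) b
  rw [Waux, hsub, max_eq_left (by linarith)]
  ring

end

lemma swapX_eq (X : ℕ → ℕ → ℝ) (k n : ℕ) : swapX X k n = X (Equiv.swap k (k + 1) n) := by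
  ext t
  unfold swapX
  rw [Equiv.swap_apply_def]
  split_ifs <;> rfl

lemma swapQ_of_ne (Q : ℕ → ℝ) {k n : ℕ} (h : n ≠ k) (h' : n ≠ k + 1) : swapQ Q k n = Q n := by
  simp [swapQ, h, h']

lemma swap_lt_iff {k N : ℕ} (hk : k + 2 ≤ N) (n : ℕ) :
    Equiv.swap k (k + 1) n < N ↔ n < N := by
  rw [Equiv.swap_apply_def]
  split_ifs <;> omega

lemma socialOffload_swapX (T : ℕ) {N k : ℕ} (hk : k + 2 ≤ N) (f : ℕ → ℝ → ℝ) (X : ℕ → ℕ → ℝ)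
    (b : ℕ → Bool) :
    socialOffload T N f (swapX X k) b = socialOffload T N f X (b ∘ Equiv.swap k (k + 1)) := by
  unfold socialOffload
  refine sum_congr rfl fun t _ => congrArg (f t) ?_
  refine sum_equiv (Equiv.swap k (k + 1)) (fun n => ?_) fun n _ => ?_
  · simp only [mem_range, swap_lt_iff hk]
  · simp [swapX_eq]

/-- After both exchanged positions have been passed, exchanging the parameters amounts to
exchanging the corresponding outcomes. -/
lemma Waux_swap (T : ℕ) {N k : ℕ} (f : ℕ → ℝ → ℝ) (X : ℕ → ℕ → ℝ) (Q : ℕ → ℝ) (j : ℕ)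
    (hj : k + 2 + j ≤ N) (b : ℕ → Bool) :
    Waux T N f (swapX X k) (swapQ Q k) j b = Waux T N f X Q j (b ∘ Equiv.swap k (k + 1)) := by
  induction j generalizing b with
  | zero => exact socialOffload_swapX T hj f X b
  | succ j ih =>
    have hfix : Equiv.swap k (k + 1) (N - (j + 1)) = N - (j + 1) :=
      Equiv.swap_apply_of_ne_of_ne (by omega) (by omega)
    have hupd : ∀ v, Function.update b (N - (j + 1)) v ∘ Equiv.swap k (k + 1) =
        Function.update (b ∘ Equiv.swap k (k + 1)) (N - (j + 1)) v := by
      intro v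
      rw [Function.update_comp_equiv, Equiv.symm_swap, hfix]
    simp only [Waux, ih (by omega), hupd, swapQ_of_ne Q (k := k) (n := N - (j + 1)) (by omega)
      (by omega)]

/-- Before the exchanged positions are reached, the two recursions have the same coefficients. -/
lemma Waux_swap_congr {T N k i : ℕ} {f : ℕ → ℝ → ℝ} {X : ℕ → ℕ → ℝ} {Q : ℕ → ℝ}
    (hi : k + i = N)
    (h : ∀ b, Waux T N f (swapX X k) (swapQ Q k) i b = Waux T N f X Q i b) (m : ℕ) (hm : m ≤ k)
    (b : ℕ → Bool) :
    Waux T N f (swapX X k) (swapQ Q k) (i + m) b = Waux T N f X Q (i + m) b := by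
  induction m generalizing b with
  | zero => exact h b
  | succ m ih =>
    rw [← add_assoc]
    simp only [Waux, ih (by omega), swapQ_of_ne Q (k := k) (n := N - (i + m + 1)) (by omega)
      (by omega)]

/-- Proposition 4: if the VO at (paper) position `k+2` is of type 3
(`Σ_t f_t(X_{k+2}^t) + Q_{k+2} < 0`), exchanging bargaining positions `k+1` and
`k+2` leaves the MNO's payoff `U_0 = W_0` unchanged. -/
theorem swap_type3_payoff_eq (T N : ℕ) (hT : 1 ≤ T) (hN : 2 ≤ N)
    (f : ℕ → ℝ → ℝ) (X : ℕ → ℕ → ℝ) (Q : ℕ → ℝ)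
    (hf : ∀ t, t < T → MonotoneOn (f t) (Set.Ici (0 : ℝ)) ∧
      ConcaveOn ℝ (Set.Ici (0 : ℝ)) (f t) ∧ f t 0 = 0)
    (hX : ∀ n, n < N → ∀ t, t < T → 0 ≤ X n t)
    (k : ℕ) (hk : k + 2 ≤ N)
    (hQ : (∑ t ∈ range T, f t (X (k + 1) t)) + Q (k + 1) < 0) :
    W T N f (swapX X k) (swapQ Q k) 0 (fun _ => false) =
      W T N f X Q 0 (fun _ => false) := by
  have hf' : ∀ t, t < T → ConcaveOn ℝ (Set.Ici (0 : ℝ)) (f t) ∧ f t 0 = 0 :=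
    fun t ht => (hf t ht).2
  have hX' : ∀ n, n < N → ∀ t, t < T → 0 ≤ swapX X k n t := by
    intro n hn t ht
    rw [swapX_eq]
    exact hX _ ((swap_lt_iff hk n).2 hn) t ht
  have hQ' : (∑ t ∈ range T, f t (swapX X k k t)) + swapQ Q k k < 0 := by
    simpa [swapX, swapQ] using hQ
  obtain ⟨j, rfl⟩ := Nat.exists_eq_add_of_le hk
  have hbase : ∀ b, Waux T (k + 2 + j) f (swapX X k) (swapQ Q k) (j + 2) b =
      Waux T (k + 2 + j) f X Q (j + 2) b := by
    intro b
    have hidx : k + 2 + j - (j + 1) = k + 1 := by omega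
    have hidx' : k + 2 + j - (j + 1 + 1) = k := by omega
    have hQk : swapQ Q k (k + 1) = Q k := by simp [swapQ]
    have hupd : ∀ v, Function.update (Function.update b k false) (k + 1) v ∘
        Equiv.swap k (k + 1) =
        Function.update (Function.update (b ∘ Equiv.swap k (k + 1)) (k + 1) false) k v := by
      intro v
      simp only [Function.update_comp_equiv, Equiv.symm_swap, Equiv.swap_apply_left,
        Equiv.swap_apply_right]
    have hupd' : ∀ v, Function.update (Function.update (b ∘ Equiv.swap k (k + 1)) (k + 1) false)
        k v = Function.update (Function.update b k v) (k + 1) false := by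
      intro v
      ext n
      by_cases h : n = k
      · subst h; simp
      by_cases h' : n = k + 1
      · subst h'; simp
      simp [h, h', Equiv.swap_apply_of_ne_of_ne h h']
    rw [Waux_succ_of_type3 hf' hX' (by omega) hQ', Waux, hidx, hQk, Waux.eq_def _ _ _ _ _ (j + 2)]
    simp only [hidx', Waux_succ_of_type3 hf' hX (n := k + 1) (j := j) (by omega) hQ,
      Waux_swap T f X Q j le_rfl, hupd, hupd']
  have hlen : k + 2 + j - 0 = j + 2 + k := by omega
  rw [W, W, hlen]
  exact Waux_swap_congr (by omega) hbase k le_rfl _
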